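/- arXiv:2002.07906 — 2 statements merged into one kernel-verified Lean document; each statement's English description precedes it below -/
import Mathlib

section
/- Let d ≥ 1, let f : ℝ^d → ℝ be continuously differentiable on an open set containing the segment {x̄ + α(x − x̄) : α ∈ [0,1]} for given x, x̄ ∈ ℝ^d. Then the Integrated Gradients attribution satisfies completeness: Σ_{i=1}^d IG_i(f, x, x̄) = f(x) − f(x̄). -/
open MeasureTheory

/-- The `i`-th partial derivative of `f : (Fin d → ℝ) → ℝ` at a point `p`. -/
noncomputable def partialDeriv {d : ℕ} (f : (Fin d → ℝ) → ℝ) (i : Fin d) (p : Fin d → ℝ) : ℝ :=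
  deriv (fun t : ℝ => f (Function.update p i t)) (p i)

/-- The Integrated Gradients attribution. -/
noncomputable def IG {d : ℕ} (f : (Fin d → ℝ) → ℝ) (x xb : Fin d → ℝ) : Fin d → ℝ :=
  fun i => (x i - xb i) * ∫ α in (0:ℝ)..1, partialDeriv f i (xb + α • (x - xb))

theorem HasFDerivAt.partialDeriv_eq {d : ℕ} {f : (Fin d → ℝ) → ℝ} {f' : (Fin d → ℝ) →L[ℝ] ℝ}
    {p : Fin d → ℝ} (h : HasFDerivAt f f' p) (i : Fin d) :
    partialDeriv f i p = f' (Pi.single i 1) := by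
  have h' : HasFDerivAt f f' (Function.update p i (p i)) := by simpa using h
  exact (h'.comp_hasDerivAt (p i) (hasDerivAt_update p i (p i))).deriv

/-- Integrated Gradients satisfies completeness: if `f` is continuously differentiable on an
open set containing the segment from `xb` to `x`, then `∑ i, IG_i(f, x, xb) = f x − f xb`. -/
theorem IG_completeness (d : ℕ) (hd : 1 ≤ d) (f : (Fin d → ℝ) → ℝ) (x xb : Fin d → ℝ)
    (U : Set (Fin d → ℝ)) (hU : IsOpen U)
    (hseg : ∀ α ∈ Set.Icc (0:ℝ) 1, xb + α • (x - xb) ∈ U)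
    (hf : ContDiffOn ℝ 1 f U) :
    ∑ i : Fin d, IG f x xb i = f x - f xb := by
  have hderiv : ∀ α ∈ Set.Icc (0 : ℝ) 1, HasFDerivAt f (fderiv ℝ f (xb + α • (x - xb)))
      (xb + α • (x - xb)) := fun α hα =>
    ((hf.differentiableOn one_ne_zero).differentiableAt
      (hU.mem_nhds (hseg α hα))).hasFDerivAt
  have hcont : ContinuousOn (fun α : ℝ => fderiv ℝ f (xb + α • (x - xb))) (Set.Icc 0 1) :=
    (hf.continuousOn_fderiv_of_isOpen hU le_rfl).comp (by fun_prop) hseg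
  have hpart : ∀ i, ContinuousOn (fun α : ℝ => partialDeriv f i (xb + α • (x - xb)))
      (Set.Icc 0 1) := fun i =>
    (hcont.clm_apply continuousOn_const).congr fun α hα => (hderiv α hα).partialDeriv_eq i
  have hint : ∀ i, IntervalIntegrable (fun α : ℝ => (x i - xb i) *
      partialDeriv f i (xb + α • (x - xb))) volume 0 1 := fun i =>
    (continuousOn_const.mul (hpart i)).intervalIntegrable_of_Icc zero_le_one
  have hpath : ∀ α ∈ Set.uIcc (0 : ℝ) 1, HasDerivAt (fun α : ℝ => f (xb + α • (x - xb)))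
      (∑ i, (x i - xb i) * partialDeriv f i (xb + α • (x - xb))) α := by
    intro α hα
    rw [Set.uIcc_of_le zero_le_one] at hα
    have hline : HasDerivAt (fun α : ℝ => xb + α • (x - xb)) (x - xb) α := by
      simpa using ((hasDerivAt_id α).smul_const (x - xb)).const_add xb
    convert! (hderiv α hα).comp_hasDerivAt α hline using 1
    conv_rhs => arg 2; rw [pi_eq_sum_univ' (x - xb)]
    simp [(hderiv α hα).partialDeriv_eq]
  simp only [IG, ← intervalIntegral.integral_const_mul]
  rw [← intervalIntegral.integral_finsetSum fun i _ => hint i,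
    intervalIntegral.integral_eq_sub_of_hasDerivAt hpath
      (by simpa only [Finset.sum_fn] using IntervalIntegrable.sum Finset.univ fun i _ => hint i)]
  simp
end

section
/- Let n ≥ 1 and let A be a map assigning to each function g : ℝ^n → ℝ and each pair x, x̄ ∈ ℝ^n a vector A(g, x, x̄) ∈ ℝ^n. Assume (i) additivity: A(g + h, x, x̄) = A(g, x, x̄) + A(h, x, x̄) for all g, h, x, x̄, and (ii) null player: A_j(g, x, x̄) = 0 whenever g does not depend on the j-th coordinate (i.e., g(u) = g(v) for all u, v agreeing on every coordinate except possibly the j-th). Let F_1, …, F_n : ℝ^n → ℝ be functions such that for each i ∈ [n], F_i depends only on the first i coordinates, i.e., F_i(u) = F_i(v) whenever u_j = v_j for all j ≤ i. Then for any weights w_1, …, w_n ∈ ℝ and any x, x̄ ∈ ℝ^n, Σ_{i=1}^n Σ_{j=1}^i w_j · A_j(F_i, x, x̄) = Σ_{j=1}^n w_j · A_j(Σ_{i=1}^n F_i, x, x̄). -/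
/-- Intra-sequence batching: for an attribution method `A` satisfying additivity and the
null player axiom, and functions `F i` each depending only on the first `i` coordinates,
the weighted double sum of attributions equals a single attribution of the sum. -/
theorem intra_sequence_batching (n : ℕ) (hn : 1 ≤ n)
    (A : ((Fin n → ℝ) → ℝ) → (Fin n → ℝ) → (Fin n → ℝ) → Fin n → ℝ)
    (hadd : ∀ (g h : (Fin n → ℝ) → ℝ) (x xb : Fin n → ℝ),
      A (g + h) x xb = A g x xb + A h x xb)
    (hnull : ∀ (g : (Fin n → ℝ) → ℝ) (x xb : Fin n → ℝ) (j : Fin n),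
      (∀ u v : Fin n → ℝ, (∀ l : Fin n, l ≠ j → u l = v l) → g u = g v) →
      A g x xb j = 0)
    (F : Fin n → (Fin n → ℝ) → ℝ)
    (hF : ∀ (i : Fin n) (u v : Fin n → ℝ), (∀ j : Fin n, j ≤ i → u j = v j) → F i u = F i v)
    (w : Fin n → ℝ) (x xb : Fin n → ℝ) :
    ∑ i : Fin n, ∑ j ∈ Finset.Iic i, w j * A (F i) x xb j
      = ∑ j : Fin n, w j * A (fun u => ∑ i : Fin n, F i u) x xb j := by
  have hsum : A (fun u => ∑ i : Fin n, F i u) x xb = ∑ i : Fin n, A (F i) x xb := by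
    have h := map_sum (AddMonoidHom.mk' (fun g => A g x xb) fun g h => hadd g h x xb) F
      Finset.univ
    rw [← Finset.sum_fn]
    exact h
  simp only [hsum, Finset.sum_apply, Finset.mul_sum]
  rw [Finset.sum_comm (s := Finset.univ) (t := Finset.univ)]
  refine Finset.sum_congr rfl fun i _ => ?_
  refine Finset.sum_subset (Finset.subset_univ _) fun j _ hj => ?_
  have hij : ¬ j ≤ i := by simpa using hj
  rw [hnull (F i) x xb j fun u v huv => hF i u v fun l hl => huv l fun h => hij (h ▸ hl),
    mul_zero]
end
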